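/- arXiv:1410.8091 — 3 statements merged into one kernel-verified Lean document; each statement's English description precedes it below -/
import Mathlib

section
/- (Proposition 3, quantitative core.) Let 0 < δ < 1 and let f_L > 0 and c_H > 0 be real numbers. Let G be a connected finite simple graph on n ≥ 2 vertices, let i be a vertex of G having exactly one neighbor, suppose every vertex j ≠ i has benefit f_L, and i has cost c_H. If n < (c_H − f_L)/(δ f_L) + 2, then the utility of i is negative: u_i(G) = f_L · Σ_{j ≠ i} δ^{d(i,j)−1} − c_H < 0. Hence a high-type bacterium that links by a single link to a micro-colony of low-type bacteria of total size below N_{th,1} := (c_H − f_L)/(δ f_L) + 2 receives negative utility. -/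
open Finset

/-- Proposition 3, quantitative core: if a high-type bacterium
`i` (cost `c_H`) is linked by a single link to a connected graph of low-type
bacteria (each providing benefit `f_L`) of total size
`n < N_{th,1} = (c_H − f_L)/(δ f_L) + 2`, then its utility
`f_L · Σ_{j ≠ i} δ^(d(i,j)−1) − c_H` is negative. -/
theorem stmt_4 {V : Type*} [Fintype V] [DecidableEq V] (G : SimpleGraph V)
    [DecidableRel G.Adj]
    (hG : G.Connected) (n : ℕ) (hn : Fintype.card V = n) (hn2 : 2 ≤ n)
    (δ : ℝ) (hδ0 : 0 < δ) (hδ1 : δ < 1)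
    (f_L c_H : ℝ) (hfL : 0 < f_L) (hcH : 0 < c_H)
    (i : V) (hdeg : G.degree i = 1)
    (hsize : (n : ℝ) < (c_H - f_L) / (δ * f_L) + 2) :
    f_L * ∑ j ∈ Finset.univ.filter (· ≠ i), δ ^ (G.dist i j - 1) - c_H < 0 := by
  obtain ⟨a, ha⟩ := Finset.card_eq_one.mp hdeg
  have hadj : ∀ j, G.Adj i j ↔ j = a := by
    intro j
    rw [← SimpleGraph.mem_neighborFinset, ha, Finset.mem_singleton]
  have hia : G.Adj i a := (hadj a).2 rfl
  have hne : a ≠ i := hia.ne'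
  have hS : Finset.univ.filter (· ≠ i) = Finset.univ.erase i := by
    ext j; simp
  have hmem : a ∈ Finset.univ.erase i := by simp [hne]
  have hcard : (((Finset.univ.erase i).erase a).card : ℝ) = (n : ℝ) - 2 := by
    rw [Finset.card_erase_of_mem hmem, Finset.card_erase_of_mem (Finset.mem_univ i),
      Finset.card_univ, hn, Nat.sub_sub, Nat.cast_sub hn2]
    norm_num
  have hrest : ∑ j ∈ (Finset.univ.erase i).erase a, δ ^ (G.dist i j - 1)
      ≤ ((n : ℝ) - 2) * δ := by
    rw [← hcard, ← nsmul_eq_mul]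
    apply Finset.sum_le_card_nsmul
    intro j hj
    simp only [Finset.mem_erase, Finset.mem_univ, and_true] at hj
    have h0 : 0 < G.dist i j := hG.pos_dist_of_ne (Ne.symm hj.2)
    have h1 : G.dist i j ≠ 1 := fun h =>
      hj.1 ((hadj j).1 (SimpleGraph.dist_eq_one_iff_adj.mp h))
    have h2 : G.dist i j - 1 ≠ 0 := by omega
    exact pow_le_of_le_one hδ0.le hδ1.le h2
  have ha1 : δ ^ (G.dist i a - 1) = 1 := by
    rw [SimpleGraph.dist_eq_one_iff_adj.mpr hia]; simp
  rw [hS, ← Finset.add_sum_erase _ _ hmem, ha1]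
  have hlt : ((n : ℝ) - 2) * (δ * f_L) < c_H - f_L := by
    rw [← lt_div_iff₀ (by positivity)]; linarith
  have := mul_le_mul_of_nonneg_left hrest hfL.le
  linarith
end

section
/- (Monotonicity of the critical size.) For real numbers f, c, δ with 0 < f < c and (c − f)/c < δ < 1, let N(f, c, δ) denote the least positive integer M such that f · (1 − δ^M)/(1 − δ) ≥ c (it exists under these hypotheses). If (f_L, c_H, δ) and (f_L', c_H', δ') both satisfy these hypotheses and f_L ≤ f_L', c_H' ≤ c_H, and δ ≤ δ', then N(f_L', c_H', δ') ≤ N(f_L, c_H, δ). That is, the critical size is nonincreasing in the benefit f and in the spread factor δ, and nondecreasing in the cost c. -/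
/-- The critical size `N(f, c, δ)`: the least positive integer `M` such that
`f · (1 − δ^M)/(1 − δ) ≥ c`. -/
noncomputable def critN (f c δ : ℝ) : ℕ :=
  sInf {M : ℕ | 0 < M ∧ f * (1 - δ ^ M) / (1 - δ) ≥ c}

/-- monotonicity of the critical size: if `(f_L, c_H, δ)` and
`(f_L', c_H', δ')` both satisfy `0 < f < c` and `(c − f)/c < δ < 1`, and
`f_L ≤ f_L'`, `c_H' ≤ c_H`, `δ ≤ δ'`, then
`N(f_L', c_H', δ') ≤ N(f_L, c_H, δ)`: the critical size is nonincreasing in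
the benefit and the spread factor and nondecreasing in the cost. -/
theorem stmt_7 (f_L c_H δ f_L' c_H' δ' : ℝ)
    (hfL : 0 < f_L) (hfc : f_L < c_H) (hδl : (c_H - f_L) / c_H < δ) (hδ1 : δ < 1)
    (hfL' : 0 < f_L') (hfc' : f_L' < c_H') (hδl' : (c_H' - f_L') / c_H' < δ') (hδ1' : δ' < 1)
    (hff : f_L ≤ f_L') (hcc : c_H' ≤ c_H) (hδδ : δ ≤ δ') :
    critN f_L' c_H' δ' ≤ critN f_L c_H δ := by
  have hδ0 : 0 < δ := lt_trans (div_pos (by linarith) (by linarith)) hδl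
  have geo : ∀ (x : ℝ) (f : ℝ) (M : ℕ), x < 1 →
      f * (1 - x ^ M) / (1 - x) = f * ∑ k ∈ Finset.range M, x ^ k := by
    intro x f M hx
    have h1 : (1 - x) ≠ 0 := by linarith
    rw [div_eq_iff h1, mul_assoc, geom_sum_mul_neg]
  have hne : {M : ℕ | 0 < M ∧ f_L * (1 - δ ^ M) / (1 - δ) ≥ c_H}.Nonempty := by
    have h1 : c_H - f_L < δ * c_H := (div_lt_iff₀ (by linarith)).1 hδl
    have h2 : 0 < (f_L - c_H * (1 - δ)) / f_L := div_pos (by linarith) hfL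
    obtain ⟨n, hn⟩ := exists_pow_lt_of_lt_one h2 hδ1
    refine ⟨n + 1, Nat.succ_pos n, ?_⟩
    have h3 : δ ^ (n + 1) ≤ δ ^ n := pow_le_pow_of_le_one hδ0.le hδ1.le (Nat.le_succ n)
    have h4 := (lt_div_iff₀ hfL).1 (lt_of_le_of_lt h3 hn)
    rw [ge_iff_le, le_div_iff₀ (by linarith)]
    linarith
  obtain ⟨hpos, hge⟩ := Nat.sInf_mem hne
  unfold critN
  refine Nat.sInf_le ⟨hpos, ?_⟩
  rw [geo _ _ _ hδ1] at hge
  rw [geo _ _ _ hδ1']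
  refine le_trans hcc (le_trans hge ?_)
  apply mul_le_mul hff _ (Finset.sum_nonneg fun k _ => pow_nonneg hδ0.le k) hfL'.le
  exact Finset.sum_le_sum fun k _ => pow_le_pow_left₀ hδ0.le hδδ k
end

section
/- (Keep-all-or-break-all claim from the proof of Proposition 1.) Let G be a finite simple graph, δ ∈ (0,1], f : V → ℝ nonnegative, and c ≥ 0. Let i be a vertex with nonempty neighbor set N_i, let S be a nonempty subset of N_i, and let G' be the graph obtained from G by deleting the edges {i, j} for all j ∈ N_i \ S. Then u_i(G') ≤ u_i(G), where u_i(H) = Σ_{j ≠ i, j reachable from i in H} δ^{d_H(i,j)−1} f(j) − c for i non-isolated in H. Hence breaking a proper subset of one's links while remaining linked (and still paying the single cost c) never increases the utility: the only candidate best responses are maintaining all links or breaking all links. -/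
open Finset

open Classical in
/-- keep-all-or-break-all, from the proof of Proposition 1:
let `i` be a vertex with nonempty neighbor set `N_i`, `S` a nonempty subset of
`N_i`, and `G'` the graph obtained from `G` by deleting the edges `{i,j}` for
all `j ∈ N_i \ S`. Then `u_i(G') ≤ u_i(G)`, where
`u_i(H) = Σ_{j ≠ i reachable from i in H} δ^(d_H(i,j)−1) f(j) − c`:
breaking a proper subset of one's links never increases the utility. -/
theorem stmt_16 {V : Type*} [Fintype V] (G : SimpleGraph V)
    (δ : ℝ) (hδ0 : 0 < δ) (hδ1 : δ ≤ 1) (f : V → ℝ) (hf : ∀ j, 0 ≤ f j)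
    (c : ℝ) (hc : 0 ≤ c) (i : V)
    (hNi : (G.neighborSet i).Nonempty)
    (S : Set V) (hS : S.Nonempty) (hSsub : S ⊆ G.neighborSet i)
    (G' : SimpleGraph V)
    (hG' : G' = G.deleteEdges {e : Sym2 V | ∃ j ∈ G.neighborSet i \ S, e = s(i, j)}) :
    (∑ j ∈ Finset.univ.filter (fun j => j ≠ i ∧ G'.Reachable i j),
        δ ^ (G'.dist i j - 1) * f j) - c
      ≤ (∑ j ∈ Finset.univ.filter (fun j => j ≠ i ∧ G.Reachable i j),
          δ ^ (G.dist i j - 1) * f j) - c := by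
  have hle : G' ≤ G := by
    rw [hG']
    exact SimpleGraph.deleteEdges_le _
  refine sub_le_sub_right ?_ c
  refine (Finset.sum_le_sum (g := fun j => δ ^ (G.dist i j - 1) * f j) ?_).trans
    (Finset.sum_le_sum_of_subset_of_nonneg ?_ ?_)
  · intro j hj
    have hr : G'.Reachable i j := (Finset.mem_filter.1 hj).2.2
    have hd : G.dist i j ≤ G'.dist i j := by
      obtain ⟨p, hp⟩ := hr.exists_walk_length_eq_dist
      have := SimpleGraph.dist_le (p.mapLe hle)
      rw [← hp]
      simpa using this
    exact mul_le_mul_of_nonneg_right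
      (pow_le_pow_of_le_one hδ0.le hδ1 (Nat.sub_le_sub_right hd 1)) (hf j)
  · intro j hj
    have h := (Finset.mem_filter.1 hj).2
    exact Finset.mem_filter.2 ⟨Finset.mem_univ _, h.1, h.2.mono hle⟩
  · intro j _ _
    exact mul_nonneg (pow_nonneg hδ0.le _) (hf j)
end
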